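/- Let G be a finite connected simple graph and S a carton scramble on G, i.e. a scramble with ‖S‖ = sn(G) and |S| = cart(G). Then h(S) = sn(G). -/

import Mathlib

open SimpleGraph

universe u


/-- An egg of a graph `G`: a nonempty set of vertices inducing a connected subgraph. -/
def SimpleGraph.IsEgg {V : Type u} (G : SimpleGraph V) (A : Finset V) : Prop :=
  A.Nonempty ∧ (G.induce (A : Set V)).Connected

/-- A scramble on `G`: a nonempty finite collection of eggs. -/
def SimpleGraph.IsScramble {V : Type u} (G : SimpleGraph V) (S : Finset (Finset V)) : Prop :=
  S.Nonempty ∧ ∀ A ∈ S, G.IsEgg A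

/-- The hitting number `h(S)`: the minimum cardinality of a set of vertices meeting
every egg of `S`. -/
noncomputable def hittingNumber {V : Type u} (S : Finset (Finset V)) : ℕ :=
  sInf {n | ∃ H : Finset V, H.card = n ∧ ∀ A ∈ S, ∃ x ∈ H, x ∈ A}

/-- The number of edges of `G` with one endpoint in `A` and the other outside of `A`. -/
noncomputable def cutSize {V : Type u} (G : SimpleGraph V) (A : Set V) : ℕ :=
  Set.ncard {e : Sym2 V | ∃ u v, e = s(u, v) ∧ G.Adj u v ∧ u ∈ A ∧ v ∉ A}

/-- An egg-cut for a scramble `S`: a vertex subset `A` containing some egg of `S` and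
whose complement contains some egg of `S`. -/
def IsEggCut {V : Type u} (S : Finset (Finset V)) (A : Set V) : Prop :=
  (∃ B ∈ S, (B : Set V) ⊆ A) ∧ (∃ B ∈ S, (B : Set V) ⊆ Aᶜ)

/-- The egg-cut number `e(S)` (in `ℕ∞`): the minimum size of an egg-cut for `S`,
or `⊤` if no egg-cut exists. -/
noncomputable def eggCutNumber {V : Type u} (G : SimpleGraph V) (S : Finset (Finset V)) : ℕ∞ :=
  sInf {n : ℕ∞ | ∃ A : Set V, IsEggCut S A ∧ n = (cutSize G A : ℕ∞)}

/-- The order `‖S‖` of a scramble: the minimum of its hitting number and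
its egg-cut number. -/
noncomputable def scrambleOrder {V : Type u} (G : SimpleGraph V) (S : Finset (Finset V)) : ℕ∞ :=
  min (hittingNumber S : ℕ∞) (eggCutNumber G S)

/-- The scramble number `sn(G)`: the maximum order of a scramble on `G`. -/
noncomputable def scrambleNumber {V : Type u} (G : SimpleGraph V) : ℕ :=
  sSup {n | ∃ S : Finset (Finset V), G.IsScramble S ∧ scrambleOrder G S = (n : ℕ∞)}

/-- A disjoint scramble: a scramble whose eggs are pairwise disjoint. -/
def IsDisjointScramble {V : Type u} (G : SimpleGraph V) (S : Finset (Finset V)) : Prop :=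
  G.IsScramble S ∧ (S : Set (Finset V)).Pairwise fun A B => Disjoint (A : Set V) (B : Set V)

/-- The disjoint scramble number `dsn(G)`: the maximum order of a disjoint scramble on `G`. -/
noncomputable def disjointScrambleNumber {V : Type u} (G : SimpleGraph V) : ℕ :=
  sSup {n | ∃ S : Finset (Finset V), IsDisjointScramble G S ∧ scrambleOrder G S = (n : ℕ∞)}

/-- The carton number `cart(G)`: the minimum size (number of eggs) of a scramble on `G`
whose order equals the scramble number of `G`. -/
noncomputable def cartonNumber {V : Type u} (G : SimpleGraph V) : ℕ :=
  sInf {n | ∃ S : Finset (Finset V), G.IsScramble S ∧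
    scrambleOrder G S = (scrambleNumber G : ℕ∞) ∧ S.card = n}

/-- The maximum degree of a graph. -/
noncomputable def maxDeg {V : Type u} (G : SimpleGraph V) : ℕ :=
  sSup {n | ∃ v : V, (G.neighborSet v).ncard = n}

theorem hittingNumber_le_card {V : Type u} {S : Finset (Finset V)} (H : Finset V)
    (hH : ∀ A ∈ S, ∃ x ∈ H, x ∈ A) : hittingNumber S ≤ H.card :=
  Nat.sInf_le ⟨H, rfl, hH⟩

theorem exists_card_eq_hittingNumber {V : Type u} [Fintype V] {S : Finset (Finset V)}
    (hS : ∀ A ∈ S, A.Nonempty) :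
    ∃ H : Finset V, H.card = hittingNumber S ∧ ∀ A ∈ S, ∃ x ∈ H, x ∈ A := by
  have hne : {n | ∃ H : Finset V, H.card = n ∧ ∀ A ∈ S, ∃ x ∈ H, x ∈ A}.Nonempty :=
    ⟨_, Finset.univ, rfl, fun A hA => (hS A hA).imp fun x hx => ⟨Finset.mem_univ x, hx⟩⟩
  exact Nat.sInf_mem hne

/-- Removing one egg lowers the hitting number by at most one. -/
theorem hittingNumber_le_hittingNumber_erase_add_one {V : Type u} [Fintype V]
    [DecidableEq (Finset V)] {S : Finset (Finset V)} (hS : ∀ A ∈ S, A.Nonempty)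
    {E : Finset V} (hE : E ∈ S) : hittingNumber S ≤ hittingNumber (S.erase E) + 1 := by
  classical
  obtain ⟨H, hcard, hH⟩ :=
    exists_card_eq_hittingNumber (S := S.erase E) fun A hA => hS A (Finset.mem_of_mem_erase hA)
  obtain ⟨v, hv⟩ := hS E hE
  rw [← hcard]
  refine (hittingNumber_le_card (insert v H) fun A hA => ?_).trans (Finset.card_insert_le v H)
  by_cases h : A = E
  · exact ⟨v, Finset.mem_insert_self v H, h ▸ hv⟩
  · obtain ⟨x, hx, hxA⟩ := hH A (Finset.mem_erase.2 ⟨h, hA⟩)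
    exact ⟨x, Finset.mem_insert_of_mem hx, hxA⟩

theorem eggCutNumber_anti {V : Type u} (G : SimpleGraph V) {S T : Finset (Finset V)}
    (h : S ⊆ T) : eggCutNumber G T ≤ eggCutNumber G S := by
  refine sInf_le_sInf ?_
  rintro n ⟨A, ⟨⟨B, hB, hBA⟩, ⟨C, hC, hCA⟩⟩, rfl⟩
  exact ⟨A, ⟨⟨B, h hB, hBA⟩, ⟨C, h hC, hCA⟩⟩, rfl⟩

theorem eggCutNumber_singleton {V : Type u} (G : SimpleGraph V) {E : Finset V}
    (hE : E.Nonempty) : eggCutNumber G {E} = ⊤ := by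
  refine sInf_eq_top.2 ?_
  rintro n ⟨A, ⟨⟨B, hB, hBA⟩, ⟨C, hC, hCA⟩⟩, rfl⟩
  obtain rfl := Finset.mem_singleton.1 hB
  obtain rfl := Finset.mem_singleton.1 hC
  obtain ⟨v, hv⟩ := hE
  exact absurd (hBA hv) (hCA hv)

theorem scrambleOrder_le_scrambleNumber {V : Type u} [Fintype V] (G : SimpleGraph V)
    {S : Finset (Finset V)} (hS : G.IsScramble S) :
    scrambleOrder G S ≤ (scrambleNumber G : ℕ∞) := by
  have hbdd : BddAbove {n : ℕ | ∃ S : Finset (Finset V), G.IsScramble S ∧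
      scrambleOrder G S = (n : ℕ∞)} := by
    refine ⟨Fintype.card V, ?_⟩
    rintro n ⟨T, hT, hn⟩
    have hle : (n : ℕ∞) ≤ hittingNumber T := hn ▸ min_le_left _ _
    refine (Nat.cast_le.1 hle).trans (hittingNumber_le_card Finset.univ fun A hA => ?_)
    exact (hT.2 A hA).1.imp fun x hx => ⟨Finset.mem_univ x, hx⟩
  obtain ⟨n, hn⟩ := ENat.ne_top_iff_exists.1
    (ne_top_of_le_ne_top (ENat.natCast_ne_top (hittingNumber S)) (min_le_left _ (eggCutNumber G S)))
  have hn' : scrambleOrder G S = (n : ℕ∞) := hn.symm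
  rw [hn']
  exact Nat.cast_le.2 (le_csSup hbdd ⟨S, hS, hn'⟩)

theorem cartonNumber_le_card {V : Type u} (G : SimpleGraph V) {S : Finset (Finset V)}
    (hS : G.IsScramble S) (horder : scrambleOrder G S = (scrambleNumber G : ℕ∞)) :
    cartonNumber G ≤ S.card :=
  Nat.sInf_le ⟨S, hS, horder, rfl⟩

/-- For any carton scramble `S` on a finite connected simple graph `G`
(a scramble with `‖S‖ = sn(G)` and `|S| = cart(G)`), we have `h(S) = sn(G)`. -/
theorem hittingNumber_of_carton_scramble {V : Type u} [Fintype V] (G : SimpleGraph V)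
    (hconn : G.Connected) (S : Finset (Finset V)) (hS : G.IsScramble S)
    (horder : scrambleOrder G S = (scrambleNumber G : ℕ∞))
    (hsize : S.card = cartonNumber G) :
    hittingNumber S = scrambleNumber G := by
  classical
  have hne : ∀ A ∈ S, A.Nonempty := fun A hA => (hS.2 A hA).1
  obtain ⟨E, hE⟩ := hS.1
  rcases (S.erase E).eq_empty_or_nonempty with hempty | hnonempty
  · obtain rfl : S = {E} :=
      ((Finset.erase_eq_empty_iff S E).1 hempty).resolve_left (Finset.ne_empty_of_mem hE)
    rw [scrambleOrder, eggCutNumber_singleton G (hne E hE), min_eq_left le_top] at horder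
    exact Nat.cast_inj.1 horder
  · have hh : (scrambleNumber G : ℕ∞) ≤ hittingNumber S := horder ▸ min_le_left _ _
    have he : (scrambleNumber G : ℕ∞) ≤ eggCutNumber G S := horder ▸ min_le_right _ _
    refine le_antisymm ?_ (Nat.cast_le.1 hh)
    by_contra! hlt
    have hscr : G.IsScramble (S.erase E) :=
      ⟨hnonempty, fun A hA => hS.2 A (Finset.mem_of_mem_erase hA)⟩
    have herase : scrambleNumber G ≤ hittingNumber (S.erase E) :=
      Nat.le_of_lt_succ (hlt.trans_le (hittingNumber_le_hittingNumber_erase_add_one hne hE))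
    have horder' : scrambleOrder G (S.erase E) = (scrambleNumber G : ℕ∞) :=
      le_antisymm (scrambleOrder_le_scrambleNumber G hscr)
        (le_min (Nat.cast_le.2 herase) (he.trans (eggCutNumber_anti G (Finset.erase_subset E S))))
    have hcard := cartonNumber_le_card G hscr horder'
    exact (hsize ▸ hcard).not_gt (Finset.card_erase_lt_of_mem hE)
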